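/- For every nonnegative integer n and every complex number x, 4 E_n(x) + 3 Σ_{k=1}^{⌊n/6⌋} C(n,6k) E_{n-6k}(x) = x^n + (x−1)^n + (−1)^n V_n(1−2x, x²−x+1). -/

import Mathlib

open Finset

/-- The Lucas sequence `V_n(b,c)`: `V_0 = 2`, `V_1 = b`, `V_{n+2} = b V_{n+1} - c V_n`. -/
noncomputable def lucasV (b c : ℂ) : ℕ → ℂ
  | 0 => 2
  | 1 => b
  | n + 2 => b * lucasV b c (n + 1) - c * lucasV b c n

/-- The Binet formula for the Lucas sequence `V_n`. -/
theorem lucasV_add_mul (a b : ℂ) (n : ℕ) : lucasV (a + b) (a * b) n = a ^ n + b ^ n := by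
  induction n using Nat.twoStepInduction with
  | zero => norm_num [lucasV]
  | one => simp [lucasV]
  | more n h₁ h₂ => rw [lucasV, h₁, h₂]; ring

/-- The formal power series of `exp (a * t)`. -/
noncomputable def expSeries (a : ℂ) : PowerSeries ℂ :=
  PowerSeries.mk fun n => a ^ n / (n.factorial : ℂ)

theorem coeff_expSeries (a : ℂ) (n : ℕ) :
    PowerSeries.coeff n (expSeries a) = a ^ n / (n.factorial : ℂ) := by
  simp [expSeries]

theorem expSeries_eq_rescale (a : ℂ) :
    expSeries a = PowerSeries.rescale a (PowerSeries.exp ℂ) := by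
  ext n
  simp [coeff_expSeries, PowerSeries.coeff_rescale, PowerSeries.coeff_exp, div_eq_mul_inv]

theorem expSeries_add (a b : ℂ) : expSeries (a + b) = expSeries a * expSeries b := by
  simp only [expSeries_eq_rescale, PowerSeries.exp_mul_exp_eq_exp_add]

theorem factorial_mul_coeff_egf_mul (a b : ℕ → ℂ) (n : ℕ) :
    (n.factorial : ℂ) * PowerSeries.coeff n
        (PowerSeries.mk (fun i => a i / (i.factorial : ℂ)) *
          PowerSeries.mk fun i => b i / (i.factorial : ℂ)) =
      ∑ i ∈ range (n + 1), (n.choose i : ℂ) * a i * b (n - i) := by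
  rw [PowerSeries.coeff_mul, Nat.sum_antidiagonal_eq_sum_range_succ_mk, mul_sum]
  refine sum_congr rfl fun i hi => ?_
  rw [Nat.cast_choose ℂ (Nat.lt_succ_iff.mp (mem_range.mp hi))]
  simp only [PowerSeries.coeff_mk]
  have h₁ : (i.factorial : ℂ) ≠ 0 := mod_cast i.factorial_ne_zero
  have h₂ : ((n - i).factorial : ℂ) ≠ 0 := mod_cast (n - i).factorial_ne_zero
  field_simp

theorem sum_range_ite_six_dvd (n : ℕ) (f : ℕ → ℂ) :
    ∑ i ∈ range (n + 1), (if 6 ∣ i then f i else 0) =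
      f 0 + ∑ k ∈ Icc 1 (n / 6), f (6 * k) := by
  have h : ∑ k ∈ range (n / 6 + 1), f (6 * k) = f 0 + ∑ k ∈ Icc 1 (n / 6), f (6 * k) := by
    rw [range_eq_Ico, sum_eq_sum_Ico_succ_bot (Nat.succ_pos _)]
    rfl
  rw [← h, ← sum_filter]
  symm
  refine sum_nbij (6 * ·) ?_ ?_ ?_ ?_
  · intro k hk
    simp only [mem_range, mem_filter] at hk ⊢
    omega
  · intro a _ b _ hab
    simp only at hab
    omega
  · intro i hi
    simp only [coe_filter, mem_range, Set.mem_ofPred_eq] at hi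
    obtain ⟨hi, k, rfl⟩ := hi
    exact ⟨k, by simp only [coe_range, Set.mem_Iio]; omega, rfl⟩
  · intro k _
    rfl

/-- The sum of the `n`-th powers of the sixth roots of unity, generated by a root of
`w ^ 2 - w + 1`. -/
theorem sum_pow_sixth_roots {w : ℂ} (hw : w ^ 2 = w - 1) (n : ℕ) :
    1 ^ n + w ^ n + (w - 1) ^ n + (-1) ^ n + (-w) ^ n + (1 - w) ^ n =
      if 6 ∣ n then 6 else 0 := by
  have h3 : w ^ 3 = -1 := by linear_combination (w + 1) * hw
  have h6 : w ^ 6 = 1 := by linear_combination (w ^ 3 - 1) * h3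
  have e₁ : w - 1 = w ^ 2 := hw.symm
  have e₂ : (-1 : ℂ) = w ^ 3 := h3.symm
  have e₃ : -w = w ^ 4 := by linear_combination -w * h3
  have e₄ : 1 - w = w ^ 5 := by linear_combination -w ^ 2 * h3 + hw
  have hper (k : ℕ) : (w ^ k) ^ n = (w ^ k) ^ (n % 6) := by
    conv_lhs => rw [← Nat.div_add_mod n 6]
    rw [pow_add, ← pow_mul, ← pow_mul, show k * (6 * (n / 6)) = 6 * (k * (n / 6)) by ring,
      pow_mul, h6, one_pow, one_mul, pow_mul]
  have h₁ := hper 1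
  rw [pow_one] at h₁
  rw [e₁, e₂, e₃, e₄, one_pow, h₁, hper 2, hper 3, hper 4, hper 5,
    ← e₁, ← e₂, ← e₃, ← e₄]
  have hlt : n % 6 < 6 := Nat.mod_lt _ (by norm_num)
  simp only [Nat.dvd_iff_mod_eq_zero]
  generalize n % 6 = r at hlt
  interval_cases r
  · norm_num
  · norm_num
    ring
  · norm_num
    linear_combination 4 * hw
  · norm_num
    ring
  · norm_num
    linear_combination (4 * w ^ 2 - 4 * w + 4) * hw
  · norm_num
    ring

theorem exists_sq_eq_sub_one : ∃ w : ℂ, w ^ 2 = w - 1 := by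
  obtain ⟨s, hs⟩ := IsAlgClosed.exists_pow_nat_eq (-3 : ℂ) (n := 2) two_pos
  exact ⟨(1 + s) / 2, by linear_combination hs / 4⟩

/-- Six-section of `1 + 3 * exp` as a combination of exponentials. -/
theorem two_mul_mk_six_section {w : ℂ} (hw : w ^ 2 = w - 1) :
    2 * PowerSeries.mk (fun i => ((if i = 0 then 1 else 0) + if 6 ∣ i then 3 else 0) /
        (i.factorial : ℂ)) =
      2 + (expSeries 1 + expSeries w + expSeries (w - 1) + expSeries (-1) + expSeries (-w) +
        expSeries (1 - w)) := by
  ext n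
  have h := sum_pow_sixth_roots hw n
  rw [two_mul, ← one_add_one_eq_two (R := PowerSeries ℂ)]
  simp only [map_add, PowerSeries.coeff_mk, coeff_expSeries, PowerSeries.coeff_one, ← add_div]
  rw [h]
  rcases eq_or_ne n 0 with rfl | hn
  · norm_num
  · split_ifs <;> simp_all
    ring

theorem euler_poly_lacunary_recurrence (E : ℕ → ℂ → ℂ)
    (hE : ∀ n x, E n x + ∑ r ∈ Finset.range (n + 1), (n.choose r : ℂ) * E r x = 2 * x ^ n)
    (n : ℕ) (x : ℂ) :
    4 * E n x + 3 * ∑ k ∈ Finset.Icc 1 (n / 6), (n.choose (6 * k) : ℂ) * E (n - 6 * k) x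
    = x ^ n + (x - 1) ^ n + (-1 : ℂ) ^ n * lucasV (1 - 2 * x) (x ^ 2 - x + 1) n := by
  obtain ⟨w, hw⟩ := exists_sq_eq_sub_one
  have hfac (m : ℕ) : (m.factorial : ℂ) ≠ 0 := mod_cast m.factorial_ne_zero
  set F : PowerSeries ℂ := PowerSeries.mk fun i => E i x / (i.factorial : ℂ) with hF
  set G : PowerSeries ℂ := PowerSeries.mk fun i =>
    ((if i = 0 then 1 else 0) + if 6 ∣ i then 3 else 0) / (i.factorial : ℂ) with hG
  have hFexp : F * (1 + expSeries 1) = 2 * expSeries x := by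
    ext m
    apply mul_left_cancel₀ (hfac m)
    rw [mul_add, mul_one, map_add, mul_add, hF, expSeries, factorial_mul_coeff_egf_mul,
      two_mul, map_add, coeff_expSeries, PowerSeries.coeff_mk, mul_div_cancel₀ _ (hfac m),
      mul_add, mul_div_cancel₀ _ (hfac m), ← two_mul, ← hE m x]
    simp
  have hG2 : 2 * G = 2 + (expSeries 1 + expSeries w + expSeries (w - 1) + expSeries (-1) +
      expSeries (-w) + expSeries (1 - w)) := two_mul_mk_six_section hw
  have hne : 2 * (1 + expSeries 1) ≠ 0 := by
    intro h
    have h0 := congrArg (PowerSeries.coeff 0) h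
    rw [two_mul] at h0
    simp only [map_add, PowerSeries.coeff_one, coeff_expSeries, map_zero] at h0
    norm_num at h0
  have hGF : G * F = expSeries x + expSeries (x - 1) + expSeries (x + (w - 1)) +
      expSeries (x + -w) := by
    apply mul_left_cancel₀ hne
    have h₀ : expSeries (-1) * expSeries 1 = 1 := by
      rw [← expSeries_add]
      ext m
      rcases eq_or_ne m 0 with rfl | hm <;> simp_all [coeff_expSeries, PowerSeries.coeff_one]
    have h₁ : expSeries w = expSeries (w - 1) * expSeries 1 := by
      rw [← expSeries_add, sub_add_cancel]
    have h₂ : expSeries (1 - w) = expSeries (-w) * expSeries 1 := by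
      rw [← expSeries_add, neg_add_eq_sub]
    rw [sub_eq_add_neg x 1, expSeries_add x, expSeries_add x, expSeries_add x]
    rw [h₁, h₂] at hG2
    linear_combination 2 * G * hFexp + 2 * expSeries x * hG2 - 2 * expSeries x * h₀
  have hn := congrArg (fun P => (n.factorial : ℂ) * PowerSeries.coeff n P) hGF
  simp only [hG, hF, factorial_mul_coeff_egf_mul, map_add, coeff_expSeries, ← add_div,
    mul_div_cancel₀ _ (hfac n)] at hn
  have hV : (-1 : ℂ) ^ n * lucasV (1 - 2 * x) (x ^ 2 - x + 1) n =
      (x + (w - 1)) ^ n + (x + -w) ^ n := by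
    rw [show 1 - 2 * x = -(x + (w - 1)) + -(x + -w) by ring,
      show x ^ 2 - x + 1 = -(x + (w - 1)) * -(x + -w) by linear_combination hw,
      lucasV_add_mul, mul_add, ← mul_pow, ← mul_pow]
    simp
  rw [hV, ← add_assoc, ← hn]
  simp only [mul_add, add_mul, sum_add_distrib, mul_ite, ite_mul, mul_zero, zero_mul]
  rw [sum_range_ite_six_dvd n fun i => (n.choose i : ℂ) * 3 * E (n - i) x, mul_sum]
  simp only [sum_ite_eq', mem_range, Nat.succ_pos, if_true, Nat.choose_zero_right, Nat.cast_one,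
    Nat.sub_zero]
  rw [← add_assoc]
  congr 1
  · ring
  · exact sum_congr rfl fun k _ => by ring
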